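/- Define η : (0, ∞) → ℝ by η(t) = 1 / (1 - e^{-t}). Then for all t > 0, t²·(d/dt)(t²·η'(t)) > 0, where η' denotes the derivative of η. -/

import Mathlib

/-- Equivalent to `tanh (t / 2) < t / 2`. -/
lemma sub_two_add_mul_exp_neg_pos {t : ℝ} (ht : 0 < t) :
    0 < (t - 2) + (t + 2) * Real.exp (-t) := by
  have hderiv (x : ℝ) : HasDerivAt (fun s : ℝ => (s - 2) + (s + 2) * Real.exp (-s))
      (1 - (x + 1) * Real.exp (-x)) x := by
    have h := ((hasDerivAt_id x).sub_const 2).add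
      (((hasDerivAt_id x).add_const 2).mul (hasDerivAt_neg x).exp)
    refine h.congr_deriv ?_
    simp only [id]
    ring
  have hmono : StrictMonoOn (fun s : ℝ => (s - 2) + (s + 2) * Real.exp (-s)) (Set.Ici 0) := by
    refine strictMonoOn_of_deriv_pos (convex_Ici 0) (by fun_prop) fun x hx => ?_
    rw [interior_Ici, Set.mem_Ioi] at hx
    rw [(hderiv x).deriv, sub_pos, Real.exp_neg, ← div_eq_mul_inv, div_lt_one (Real.exp_pos x)]
    exact Real.add_one_lt_exp hx.ne'
  simpa using hmono Set.self_mem_Ici ht.le ht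

lemma one_sub_exp_neg_pos {t : ℝ} (ht : 0 < t) : 0 < 1 - Real.exp (-t) :=
  by simpa using ht

lemma hasDerivAt_one_sub_exp_neg (t : ℝ) :
    HasDerivAt (fun u : ℝ => 1 - Real.exp (-u)) (Real.exp (-t)) t := by
  simpa using (hasDerivAt_neg t).exp.const_sub 1

lemma deriv_one_div_one_sub_exp_neg {t : ℝ} (ht : 0 < t) :
    deriv (fun u : ℝ => 1 / (1 - Real.exp (-u))) t =
      -Real.exp (-t) / (1 - Real.exp (-t)) ^ 2 := by
  simpa only [one_div] using
    ((hasDerivAt_one_sub_exp_neg t).fun_inv (one_sub_exp_neg_pos ht).ne').deriv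

lemma hasDerivAt_sq_mul_deriv_one_div_one_sub_exp_neg {t : ℝ} (ht : 0 < t) :
    HasDerivAt (fun s : ℝ => s ^ 2 * deriv (fun u : ℝ => 1 / (1 - Real.exp (-u))) s)
      (t * Real.exp (-t) * ((t - 2) + (t + 2) * Real.exp (-t)) / (1 - Real.exp (-t)) ^ 3) t := by
  have hne := (one_sub_exp_neg_pos ht).ne'
  have h := (hasDerivAt_pow 2 t).fun_mul (((hasDerivAt_neg t).exp.fun_neg).fun_div
    ((hasDerivAt_one_sub_exp_neg t).fun_pow 2) (pow_ne_zero 2 hne))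
  refine (h.congr_deriv ?_).congr_of_eventuallyEq ?_
  · field_simp
    ring
  · filter_upwards [lt_mem_nhds ht] with s hs
    rw [deriv_one_div_one_sub_exp_neg hs]

/-- For `η(t) = 1 / (1 - e^(-t))` and every `t > 0`,
`t^2 * (d/dt)(t^2 * η'(t)) > 0`. -/
theorem stmt_4 (t : ℝ) (ht : 0 < t) :
    0 < t ^ 2 *
      deriv (fun s : ℝ => s ^ 2 * deriv (fun u : ℝ => 1 / (1 - Real.exp (-u))) s) t := by
  rw [(hasDerivAt_sq_mul_deriv_one_div_one_sub_exp_neg ht).deriv]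
  have h₁ := sub_two_add_mul_exp_neg_pos ht
  have h₂ := one_sub_exp_neg_pos ht
  positivity
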